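/- Cost of an excursion away from −1 for paths confined below 1 (Lemma 6.1): Assume V satisfies Assumption 1. There exists C < ∞ such that for every sufficiently large M < ∞ and every sufficiently small δ > 0 there exists ℓ₀ = ℓ₀(M, δ) < ∞ with the following property. For every ℓ ≥ ℓ₀ and all u₋, u₊ ∈ [−M, 1−δ], let A^bc be the set of continuously differentiable u : ℝ → ℝ with u(−2ℓ) = u₋ and u(2ℓ) = u₊, and let A₀^bc be the set of u ∈ A^bc such that u(x) ≤ 1 − δ/2 for all x ∈ [−2ℓ, 2ℓ] and there exists x₀ ∈ [−ℓ, ℓ] with u(x₀) ≥ −δ/2. Then inf_{u ∈ A₀^bc} E_{(−2ℓ,2ℓ)}(u) − inf_{u ∈ A^bc} E_{(−2ℓ,2ℓ)}(u) ≥ c₀ − C·δ. -/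

import Mathlib

open MeasureTheory

/-- Assumption 1: `V` is smooth, even, nonnegative, and on `(0,∞)` it vanishes only at `1`,
its derivative vanishes only at `1`, `V''(1) > 0`, and `V` grows at least like `u^{1+β}`. -/
structure Assumption1 (V : ℝ → ℝ) : Prop where
  smooth : ContDiff ℝ (⊤ : ℕ∞) V
  even : ∀ u : ℝ, V (-u) = V u
  nonneg : ∀ u : ℝ, 0 ≤ V u
  zero_iff : ∀ u : ℝ, 0 < u → (V u = 0 ↔ u = 1)
  deriv_zero_iff : ∀ u : ℝ, 0 < u → (deriv V u = 0 ↔ u = 1)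
  second_deriv_pos : 0 < deriv (deriv V) 1
  growth : ∃ C : ℝ, 0 < C ∧ ∃ β : ℝ, 0 < β ∧ ∀ u : ℝ, C ≤ u → u ^ (1 + β) / C ≤ V u

/-- The energy of `u` on `(a,b)`: `E_{(a,b)}(u) = ∫_a^b ((1/2) u'² + V(u))`. -/
noncomputable def energy (V : ℝ → ℝ) (a b : ℝ) (u : ℝ → ℝ) : ℝ :=
  ∫ x in a..b, ((1/2) * (deriv u x)^2 + V (u x))

/-- The transition energy `c₀ = ∫_{-1}^{1} √(2 V(s)) ds`. -/
noncomputable def c0 (V : ℝ → ℝ) : ℝ := ∫ s in (-1:ℝ)..1, Real.sqrt (2 * V s)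


noncomputable def Phi (V : ℝ → ℝ) (t : ℝ) : ℝ := ∫ s in (-1:ℝ)..t, Real.sqrt (2 * V s)

lemma cV {V : ℝ → ℝ} (hV : Assumption1 V) : Continuous V := hV.smooth.continuous

lemma cphi {V : ℝ → ℝ} (hV : Assumption1 V) : Continuous (fun s => Real.sqrt (2 * V s)) := by
  have := cV hV
  fun_prop

lemma Phi_deriv {V : ℝ → ℝ} (hV : Assumption1 V) (t : ℝ) :
    HasDerivAt (Phi V) (Real.sqrt (2 * V t)) t := by
  have := (cphi hV).integral_hasStrictDerivAt (-1) t
  exact this.hasDerivAt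

lemma Phi_neg_one (V : ℝ → ℝ) : Phi V (-1) = 0 := by simp [Phi]

lemma Phi_mono {V : ℝ → ℝ} (hV : Assumption1 V) : Monotone (Phi V) := by
  apply monotone_of_deriv_nonneg
  · exact fun t => (Phi_deriv hV t).differentiableAt
  · intro t
    rw [(Phi_deriv hV t).deriv]; positivity

lemma two_Phi_zero {V : ℝ → ℝ} (hV : Assumption1 V) : c0 V = 2 * Phi V 0 := by
  have hc := cphi hV
  have h1 : c0 V = (∫ s in (-1:ℝ)..0, Real.sqrt (2 * V s)) + ∫ s in (0:ℝ)..1, Real.sqrt (2 * V s) :=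
    (intervalIntegral.integral_add_adjacent_intervals (hc.intervalIntegrable _ _)
      (hc.intervalIntegrable _ _)).symm
  have h2 : (∫ s in (0:ℝ)..1, Real.sqrt (2 * V s)) = ∫ s in (-1:ℝ)..0, Real.sqrt (2 * V s) := by
    have := intervalIntegral.integral_comp_neg (a := 0) (b := 1) (fun s => Real.sqrt (2 * V s))
    simp only [hV.even] at this
    simpa using this
  rw [h1, h2, Phi]; ring

lemma V_one {V : ℝ → ℝ} (hV : Assumption1 V) : V 1 = 0 := (hV.zero_iff 1 one_pos).2 rfl

lemma V_neg_one {V : ℝ → ℝ} (hV : Assumption1 V) : V (-1) = 0 := by rw [hV.even, V_one hV]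

lemma V_zero_pos {V : ℝ → ℝ} (hV : Assumption1 V) : V 0 ≠ 0 := by
  intro h
  obtain ⟨c, hc, hd⟩ := exists_deriv_eq_zero (f := V) one_pos (cV hV).continuousOn
    (by rw [h, V_one hV])
  have := (hV.deriv_zero_iff c hc.1).1 hd
  linarith [hc.2]

lemma V_pos {V : ℝ → ℝ} (hV : Assumption1 V) (u : ℝ) (h1 : u ≠ 1) (h2 : u ≠ -1) : 0 < V u := by
  refine lt_of_le_of_ne (hV.nonneg u) (fun h => ?_)
  rcases lt_trichotomy u 0 with h0 | h0 | h0
  · have := (hV.zero_iff (-u) (by linarith)).1 (by rw [hV.even]; exact h.symm)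
    apply h2; linarith
  · subst h0; exact V_zero_pos hV h.symm
  · exact h1 ((hV.zero_iff u h0).1 h.symm)

/-- quantitative positivity -/
lemma V_eta {V : ℝ → ℝ} (hV : Assumption1 V) (δ ρ : ℝ) (hδ : 0 < δ) (hδ1 : δ ≤ 1)
    (hρ : 0 < ρ) (hρ1 : ρ ≤ 1) :
    ∃ η : ℝ, 0 < η ∧ ∀ u : ℝ, u ≤ 1 - δ/2 → ρ ≤ |u + 1| → η ≤ V u := by
  obtain ⟨C, hC, β, hβ, hg⟩ := hV.growth
  have hlarge : ∀ u : ℝ, C ≤ u → 1 ≤ u → 1 / C ≤ V u := by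
    intro u h1 h2
    refine le_trans ?_ (hg u h1)
    gcongr
    exact Real.one_le_rpow h2 (by linarith)
  set R := max C 1
  let K : Set ℝ := Set.Icc (-R) R ∩ ({u | u ≤ 1 - δ/2} ∩ {u | ρ ≤ |u + 1|})
  have hK : IsCompact K := by
    apply isCompact_Icc.inter_right
    exact (isClosed_le (by fun_prop) (by fun_prop)).inter (isClosed_le (by fun_prop) (by fun_prop))
  have hR : 1 ≤ R := le_max_right _ _
  have hne : K.Nonempty := by
    refine ⟨0, ⟨by linarith, by linarith⟩, ?_, ?_⟩
    · simp only [Set.mem_ofPred_eq]; linarith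
    · simpa using hρ1
  obtain ⟨w, hw, hmin⟩ := hK.exists_isMinOn hne (cV hV).continuousOn
  have hwpos : 0 < V w := by
    apply V_pos hV
    · rintro rfl
      have : (1:ℝ) ≤ 1 - δ/2 := hw.2.1
      linarith
    · rintro rfl
      have : ρ ≤ |(-1:ℝ) + 1| := hw.2.2
      norm_num at this
      linarith
  refine ⟨min (V w) (1 / C), by positivity, fun u h1 h2 => ?_⟩
  by_cases hu : u ∈ Set.Icc (-R) R
  · exact (min_le_left _ _).trans (hmin ⟨hu, h1, h2⟩)
  · refine (min_le_right _ _).trans ?_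
    have : u < -R := by
      by_contra hcon
      exact hu ⟨not_lt.1 hcon, by linarith⟩
    rw [← hV.even]
    apply hlarge <;> linarith [le_max_left C 1]

lemma c_int {V : ℝ → ℝ} (hV : Assumption1 V) (u : ℝ → ℝ) (hu : ContDiff ℝ 1 u) :
    Continuous (fun x => (1/2) * (deriv u x)^2 + V (u x)) := by
  have h1 := hu.continuous_deriv le_rfl
  have h2 := hu.continuous
  have h3 := cV hV
  fun_prop

lemma energy_split {V : ℝ → ℝ} (hV : Assumption1 V) (u : ℝ → ℝ) (hu : ContDiff ℝ 1 u) (a b c : ℝ) :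
    energy V a c u = energy V a b u + energy V b c u :=
  (intervalIntegral.integral_add_adjacent_intervals ((c_int hV u hu).intervalIntegrable _ _)
      ((c_int hV u hu).intervalIntegrable _ _)).symm

lemma energy_nonneg {V : ℝ → ℝ} (hV : Assumption1 V) (u : ℝ → ℝ) (a b : ℝ) (hab : a ≤ b) :
    0 ≤ energy V a b u := by
  apply intervalIntegral.integral_nonneg hab
  intro x _
  have := hV.nonneg (u x)
  positivity

lemma energy_lower {V : ℝ → ℝ} (hV : Assumption1 V) (u : ℝ → ℝ) (hu : ContDiff ℝ 1 u) (a b : ℝ)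
    (hab : a ≤ b) : |Phi V (u b) - Phi V (u a)| ≤ energy V a b u := by
  have hd := hu.continuous_deriv le_rfl
  have h2 := hu.continuous
  have h3 := cphi hV
  have hint : Continuous (fun x => Real.sqrt (2 * V (u x)) * deriv u x) :=
    (h3.comp h2).mul hd
  have hF : ∀ x, HasDerivAt (fun x => Phi V (u x)) (Real.sqrt (2 * V (u x)) * deriv u x) x :=
    fun x => (Phi_deriv hV (u x)).comp x (hu.differentiable one_ne_zero x).hasDerivAt
  have key := intervalIntegral.integral_eq_sub_of_hasDerivAt (a := a) (b := b)
    (fun x _ => hF x) (hint.intervalIntegrable _ _)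
  rw [← key]
  refine (intervalIntegral.abs_integral_le_integral_abs hab).trans ?_
  apply intervalIntegral.integral_mono_on hab (hint.abs.intervalIntegrable _ _)
    ((c_int hV u hu).intervalIntegrable _ _)
  intro x _
  have hs := Real.sq_sqrt (show 0 ≤ 2 * V (u x) by linarith [hV.nonneg (u x)])
  have h5 := Real.sqrt_nonneg (2 * V (u x))
  rw [abs_mul, abs_of_nonneg h5]
  nlinarith [sq_nonneg (Real.sqrt (2 * V (u x)) - |deriv u x|), sq_abs (deriv u x)]

lemma exists_low {V : ℝ → ℝ} (hV : Assumption1 V) (u : ℝ → ℝ) (hu : ContDiff ℝ 1 u) (a b η : ℝ)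
    (hab : a ≤ b) (h : energy V a b u < η * (b - a)) : ∃ y ∈ Set.Icc a b, V (u y) < η := by
  by_contra! hcon
  have : η * (b - a) ≤ energy V a b u := by
    have h1 : ∫ x in a..b, η = η * (b - a) := by simp [mul_comm]
    rw [← h1]
    apply intervalIntegral.integral_mono_on hab (by simp) ((c_int hV u hu).intervalIntegrable _ _)
    intro x hx
    nlinarith [hcon x hx, sq_nonneg (deriv u x)]
  linarith

/-- Inverse of a primitive of a continuous function bounded below by a positive constant. -/
lemma exists_time_change (τ : ℝ → ℝ) (hτ : Continuous τ) (c : ℝ) (hc : 0 < c)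
    (hle : ∀ t, c ≤ τ t) : ∃ S : ℝ → ℝ, Monotone S ∧ S 0 = 0 ∧ Continuous S ∧
      (∀ x, HasDerivAt S (τ (S x))⁻¹ x) ∧ ∀ t, S (∫ r in (0:ℝ)..t, τ r) = t := by
  let T : ℝ → ℝ := fun t => ∫ r in (0:ℝ)..t, τ r
  have hT : ∀ t, HasDerivAt T (τ t) t := fun t => (hτ.integral_hasStrictDerivAt 0 t).hasDerivAt
  have hTc : Continuous T := continuous_iff_continuousAt.2 fun t => (hT t).continuousAt
  have hpos : ∀ t, 0 < τ t := fun t => hc.trans_le (hle t)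
  have hmono : StrictMono T := by
    apply strictMono_of_deriv_pos
    intro t; rw [(hT t).deriv]; exact hpos t
  have hm2 : Monotone (fun t => T t - c * t) := by
    have hd : ∀ t, HasDerivAt (fun t => T t - c * t) (τ t - c) t := fun t => by
      have h := (hT t).sub ((hasDerivAt_id t).const_mul c)
      rw [mul_one] at h
      exact h
    apply monotone_of_deriv_nonneg
    · exact fun t => (hd t).differentiableAt
    · intro t; rw [(hd t).deriv]; linarith [hle t]
  have hT0 : T 0 = 0 := by simp [T]
  have hsurj : Function.Surjective T := by
    apply hTc.surjective
    · apply Filter.tendsto_atTop_mono' (f₁ := fun t => c * t)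
      · filter_upwards [Filter.eventually_ge_atTop 0] with t ht
        have := hm2 ht
        simp only [hT0] at this
        linarith
      · exact Filter.tendsto_id.const_mul_atTop hc
    · apply Filter.tendsto_atBot_mono' (f₁ := fun t => c * t)
      · filter_upwards [Filter.eventually_le_atBot 0] with t ht
        have := hm2 ht
        simp only [hT0] at this
        linarith
      · exact Filter.tendsto_id.const_mul_atBot hc
  let e := hmono.orderIsoOfSurjective T hsurj
  have he : ∀ t, e t = T t := fun t => rfl
  have hSc : Continuous e.symm := e.symm.continuous
  refine ⟨e.symm, e.symm.monotone, ?_, hSc, ?_, ?_⟩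
  · rw [OrderIso.symm_apply_eq, he, hT0]
  · intro x
    apply HasDerivAt.of_local_left_inverse (f := T) hSc.continuousAt (hT _) (hpos _).ne'
    exact Filter.Eventually.of_forall fun y => e.apply_symm_apply y
  · intro t
    exact e.symm_apply_apply t

lemma half_profile {V : ℝ → ℝ} (hV : Assumption1 V) (M δ : ℝ) (hδ : 0 < δ) :
    ∃ L : ℝ, 0 < L ∧ ∀ a ∈ Set.Icc (-M) 1, ∃ P : ℝ → ℝ, ContDiff ℝ 1 P ∧ P 0 = a ∧
      (∀ x, L ≤ x → P x = -1) ∧ energy V 0 L P ≤ |Phi V a| + δ := by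
  have hVc := cV hV
  -- the bound on V
  obtain ⟨R, hR⟩ := (isCompact_Icc (a := -(|M|+1)) (b := 1)).exists_bound_of_continuousOn
    (f := fun s => Real.sqrt (2 * V s + 1)) (by fun_prop)
  have hR' : ∀ s ∈ Set.Icc (-(|M|+1)) 1, Real.sqrt (2 * V s + 1) ≤ R := fun s hs =>
    (le_abs_self _).trans (hR s hs)
  have hR0 : 0 ≤ R := (Real.sqrt_nonneg _).trans (hR' 1 ⟨by linarith [abs_nonneg M], le_rfl⟩)
  let σ := Real.smoothTransition
  have hσ : ContDiff ℝ 1 σ := Real.smoothTransition.contDiff (n := 1)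
  have hσ' : Continuous (deriv σ) := hσ.continuous_deriv le_rfl
  have hσd : ∀ t, HasDerivAt σ (deriv σ t) t := fun t =>
    (hσ.differentiable one_ne_zero t).hasDerivAt
  have hσn : ∀ t, 0 ≤ deriv σ t := fun t => Real.smoothTransition.monotone.deriv_nonneg
  have hσ1 : ∀ t, 1 ≤ t → deriv σ t = 0 := by
    intro t ht
    apply IsLocalMax.deriv_eq_zero
    apply Filter.Eventually.of_forall
    intro y
    rw [show σ t = 1 from Real.smoothTransition.one_of_one_le ht]
    exact Real.smoothTransition.le_one y
  obtain ⟨B, hB⟩ := (isCompact_Icc (a := (0:ℝ)) (b := 1)).exists_bound_of_continuousOn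
    (f := deriv σ) hσ'.continuousOn
  have hB' : ∀ s ∈ Set.Icc (0:ℝ) 1, deriv σ s ≤ B := fun s hs =>
    (le_abs_self _).trans (hB s hs)
  have hB0 : 0 ≤ B := (hσn 0).trans (hB' 0 (by simp))
  set A := |M| + 2 with hA
  have hA0 : 0 < A := by positivity
  set ε := min 1 (δ / (A + R)) with hε
  have hε0 : 0 < ε := by positivity
  have hε1 : ε ≤ 1 := min_le_left _ _
  have hεδ : ε * (A + R) ≤ δ := by
    have : ε ≤ δ / (A + R) := min_le_right _ _
    rwa [le_div_iff₀ (by positivity)] at this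
  refine ⟨(A * B + ε) / ε, by positivity, fun a ha => ?_⟩
  have haA : |-1 - a| ≤ A := by
    rw [abs_le]; constructor <;> linarith [ha.1, ha.2, le_abs_self M, abs_nonneg M]
  let γ : ℝ → ℝ := fun t => a + (-1 - a) * σ t
  let g : ℝ → ℝ := fun t => (-1 - a) * deriv σ t
  have hγd : ∀ t, HasDerivAt γ (g t) t := fun t => ((hσd t).const_mul (-1 - a)).const_add a
  have hgc : Continuous g := by fun_prop
  have hγc : Continuous γ := continuous_iff_continuousAt.2 fun t => (hγd t).continuousAt
  have hγ0 : γ 0 = a := by simp [γ, σ]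
  have hγ1 : ∀ t, 1 ≤ t → γ t = -1 := fun t ht => by
    simp [γ, σ, Real.smoothTransition.one_of_one_le ht]
  have hγmem : ∀ t, γ t ∈ Set.Icc (-(|M|+1)) 1 := by
    intro t
    have h0 : 0 ≤ σ t := Real.smoothTransition.nonneg t
    have h1 : σ t ≤ 1 := Real.smoothTransition.le_one t
    have e : γ t = (1 - σ t) * a + σ t * (-1) := by simp only [γ]; ring
    rw [e]
    constructor
    · nlinarith [ha.1, le_abs_self M, abs_nonneg M]
    · nlinarith [ha.2]
  let r : ℝ → ℝ := fun t => Real.sqrt (2 * V (γ t) + ε ^ 2)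
  have hrc : Continuous r := by fun_prop
  have hrsq : ∀ t, r t ^ 2 = 2 * V (γ t) + ε ^ 2 := fun t =>
    Real.sq_sqrt (by nlinarith [hV.nonneg (γ t)])
  have hrR : ∀ t, r t ≤ R := fun t => le_trans (Real.sqrt_le_sqrt (by nlinarith)) (hR' _ (hγmem t))
  have hrε : ∀ t, ε ≤ r t := fun t => Real.le_sqrt_of_sq_le (by linarith [hV.nonneg (γ t)])
  have hr0 : ∀ t, 0 < r t := fun t => hε0.trans_le (hrε t)
  have hRpos : 0 < R := (hr0 0).trans_le (hrR 0)
  have hrphi : ∀ t, r t ≤ Real.sqrt (2 * V (γ t)) + ε := by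
    intro t
    have h1 := Real.sqrt_nonneg (2 * V (γ t))
    have h2 := Real.sq_sqrt (show 0 ≤ 2 * V (γ t) by linarith [hV.nonneg (γ t)])
    apply Real.sqrt_le_iff.2
    constructor
    · positivity
    · nlinarith
  let τ : ℝ → ℝ := fun t => (|g t| + ε) / r t
  have hτc : Continuous τ := by
    apply Continuous.div (by fun_prop) hrc (fun t => (hr0 t).ne')
  have hτle : ∀ t, ε / R ≤ τ t := by
    intro t
    apply div_le_div₀ (by positivity) (by linarith [abs_nonneg (g t)]) (hr0 t) (hrR t)
  have hτ0 : ∀ t, 0 < τ t := fun t => (by positivity : 0 < ε / R).trans_le (hτle t)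
  obtain ⟨S, hSm, hS0, hSc, hSd, hSinv⟩ := exists_time_change τ hτc (ε / R) (by positivity) hτle
  have hT1 : (∫ t in (0:ℝ)..1, τ t) ≤ (A * B + ε) / ε := by
    have h1 : ∫ t in (0:ℝ)..1, ((A * B + ε) / ε) = (A * B + ε) / ε := by simp
    rw [← h1]
    apply intervalIntegral.integral_mono_on zero_le_one (hτc.intervalIntegrable _ _) (by simp)
    intro t ht
    apply div_le_div₀ (by positivity) _ hε0 (hrε t)
    have : |g t| ≤ A * B := by
      simp only [g, abs_mul, abs_of_nonneg (hσn t)]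
      exact mul_le_mul haA (hB' t ht) (hσn t) hA0.le
    linarith
  have hPd : ∀ x, HasDerivAt (fun x => γ (S x)) (g (S x) * (τ (S x))⁻¹) x := fun x =>
    (hγd (S x)).comp x (hSd x)
  have hSL : ∀ x, (A * B + ε) / ε ≤ x → 1 ≤ S x := by
    intro x hx
    rw [← hSinv 1]
    exact hSm (hT1.trans hx)
  have hτS : Continuous fun x => (τ (S x))⁻¹ :=
    (hτc.comp hSc).inv₀ (fun x => (hτ0 _).ne')
  refine ⟨fun x => γ (S x), ?_, ?_, ?_, ?_⟩
  · rw [contDiff_one_iff_deriv]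
    refine ⟨fun x => (hPd x).differentiableAt, ?_⟩
    have : deriv (fun x => γ (S x)) = fun x => g (S x) * (τ (S x))⁻¹ :=
      funext fun x => (hPd x).deriv
    rw [this]
    exact (hgc.comp hSc).mul hτS
  · simp only [hS0, hγ0]
  · intro x hx
    exact hγ1 _ (hSL x hx)
  · let h : ℝ → ℝ := fun t => 1/2 * g t ^ 2 / τ t + V (γ t) * τ t
    have hhc : Continuous h := by
      apply Continuous.add
      · exact Continuous.div (by fun_prop) hτc (fun t => (hτ0 t).ne')
      · fun_prop
    set L := (A * B + ε) / ε
    have e1 : energy V 0 L (fun x => γ (S x)) = ∫ x in (0:ℝ)..L, (h ∘ S) x * (τ (S x))⁻¹ := by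
      unfold energy
      apply intervalIntegral.integral_congr
      intro x _
      simp only [(hPd x).deriv, h, Function.comp]
      have := (hτ0 (S x)).ne'
      field_simp
    have e2 : ∫ x in (0:ℝ)..L, (h ∘ S) x * (τ (S x))⁻¹ = ∫ t in (S 0)..(S L), h t :=
      intervalIntegral.integral_comp_mul_deriv (fun x _ => hSd x) hτS.continuousOn hhc
    have e3 : ∫ t in (S 0)..(S L), h t = (∫ t in (0:ℝ)..1, h t) + ∫ t in (1:ℝ)..(S L), h t := by
      rw [hS0]
      exact (intervalIntegral.integral_add_adjacent_intervals (hhc.intervalIntegrable _ _)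
        (hhc.intervalIntegrable _ _)).symm
    have e4 : ∫ t in (1:ℝ)..(S L), h t = 0 := by
      rw [← intervalIntegral.integral_zero (a := (1:ℝ)) (b := S L) (μ := volume)]
      apply intervalIntegral.integral_congr
      intro t ht
      rw [Set.uIcc_of_le (hSL L le_rfl)] at ht
      simp [h, g, hσ1 t ht.1, hγ1 t ht.1, V_neg_one hV]
    rw [e1, e2, e3, e4, add_zero]
    -- pointwise bound
    let k : ℝ → ℝ := fun t => (Real.sqrt (2 * V (γ t)) + ε) * g t
    have hkc : Continuous k := by fun_prop
    have hkint : ∫ t in (0:ℝ)..1, k t = -Phi V a + ε * (-1 - a) := by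
      have hd : ∀ t, HasDerivAt (fun t => Phi V (γ t) + ε * γ t) (k t) t := by
        intro t
        have := ((Phi_deriv hV (γ t)).comp t (hγd t)).add ((hγd t).const_mul ε)
        have e : k t = Real.sqrt (2 * V (γ t)) * g t + ε * g t := by
          simp only [k]; ring
        rw [e]
        exact this
      rw [intervalIntegral.integral_eq_sub_of_hasDerivAt (fun t _ => hd t)
        (hkc.intervalIntegrable _ _), hγ0, hγ1 1 le_rfl, Phi_neg_one]
      ring
    have hpt : ∀ t, h t ≤ |k t| + 1/2 * ε * R := by
      intro t
      have hk : |k t| = (Real.sqrt (2 * V (γ t)) + ε) * |g t| := by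
        simp only [k, abs_mul]
        rw [abs_of_nonneg (by positivity)]
      have hG := abs_nonneg (g t)
      have hsplit1 : 1/2 * g t ^ 2 / τ t ≤ 1/2 * |g t| * r t := by
        simp only [τ]
        rw [div_div_eq_mul_div, div_le_iff₀ (by positivity), ← sq_abs]
        have : 0 ≤ |g t| * r t * ε := mul_nonneg (mul_nonneg hG (hr0 t).le) hε0.le
        nlinarith
      have hsplit2 : V (γ t) * τ t ≤ 1/2 * r t * (|g t| + ε) := by
        simp only [τ]
        rw [← mul_div_assoc, div_le_iff₀ (hr0 t)]
        have h1 : V (γ t) ≤ 1/2 * r t ^ 2 := by nlinarith [hrsq t]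
        nlinarith
      rw [hk]
      simp only [h]
      have h3 := mul_le_mul_of_nonneg_right (hrphi t) hG
      have h4 := mul_le_mul_of_nonneg_left (hrR t) hε0.le
      nlinarith
    have hb1 : ∫ t in (0:ℝ)..1, h t ≤ ∫ t in (0:ℝ)..1, (|k t| + 1/2 * ε * R) := by
      apply intervalIntegral.integral_mono_on zero_le_one (hhc.intervalIntegrable _ _)
        (Continuous.intervalIntegrable (by fun_prop) _ _) (fun t _ => hpt t)
    have hb2 : ∫ t in (0:ℝ)..1, (|k t| + 1/2 * ε * R) = (∫ t in (0:ℝ)..1, |k t|) + 1/2 * ε * R := by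
      rw [intervalIntegral.integral_add (hkc.abs.intervalIntegrable _ _)
        (continuous_const.intervalIntegrable _ _)]
      simp
    have hb3 : ∫ t in (0:ℝ)..1, |k t| ≤ |Phi V a| + ε * A := by
      have hab := abs_le.1 haA
      rcases le_total 0 (-1 - a) with hs | hs
      · have : ∀ t, |k t| = k t := fun t => abs_of_nonneg
          (mul_nonneg (by positivity) (mul_nonneg hs (hσn t)))
        simp only [this, hkint]
        have := neg_le_abs (Phi V a)
        nlinarith
      · have : ∀ t, |k t| = - k t := fun t => abs_of_nonpos
          (mul_nonpos_of_nonneg_of_nonpos (by positivity)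
            (mul_nonpos_of_nonpos_of_nonneg hs (hσn t)))
        simp only [this, intervalIntegral.integral_neg, hkint]
        have := le_abs_self (Phi V a)
        nlinarith
    have : 0 ≤ ε * R := by positivity
    linarith

/-- competitor for the unconstrained problem -/
lemma upper {V : ℝ → ℝ} (hV : Assumption1 V) (M δ : ℝ) (hδ : 0 < δ) :
    ∃ L : ℝ, 0 < L ∧ ∀ ℓ, L ≤ 2 * ℓ → ∀ a ∈ Set.Icc (-M) 1, ∀ b ∈ Set.Icc (-M) 1,
      ∃ v : ℝ → ℝ, ContDiff ℝ 1 v ∧ v (-(2*ℓ)) = a ∧ v (2*ℓ) = b ∧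
        energy V (-(2*ℓ)) (2*ℓ) v ≤ |Phi V a| + |Phi V b| + 2 * δ := by
  obtain ⟨L, hL, H⟩ := half_profile hV M δ hδ
  refine ⟨L, hL, fun ℓ hℓ a ha b hb => ?_⟩
  obtain ⟨P, hP, hP0, hP1, hPe⟩ := H a ha
  obtain ⟨Q, hQ, hQ0, hQ1, hQe⟩ := H b hb
  -- energy on a longer interval
  have tail : ∀ P : ℝ → ℝ, ContDiff ℝ 1 P → (∀ x, L ≤ x → P x = -1) →
      energy V 0 (2*ℓ) P = energy V 0 L P := by
    intro P hP hP1
    rw [energy_split hV P hP 0 L (2*ℓ)]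
    have : energy V L (2*ℓ) P = ∫ x in L..(2*ℓ), (0:ℝ) := by
      unfold energy
      apply intervalIntegral.integral_congr_ae
      apply Filter.Eventually.of_forall
      intro x hx
      rw [Set.uIoc_of_le hℓ] at hx
      have hd : deriv P x = 0 := by
        have : P =ᶠ[nhds x] fun _ => -1 := by
          filter_upwards [lt_mem_nhds hx.1] with y hy using hP1 y hy.le
        rw [this.deriv_eq]; simp
      simp [hd, hP1 x hx.1.le, V_neg_one hV]
    rw [this]; simp
  let v : ℝ → ℝ := fun x => P (x + 2*ℓ) + Q (2*ℓ - x) + 1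
  have hPd : ∀ x, HasDerivAt P (deriv P x) x := fun x => (hP.differentiable one_ne_zero x).hasDerivAt
  have hQd : ∀ x, HasDerivAt Q (deriv Q x) x := fun x => (hQ.differentiable one_ne_zero x).hasDerivAt
  have hv : ContDiff ℝ 1 v := by
    have h1 : ContDiff ℝ 1 (fun x : ℝ => x + 2*ℓ) := by fun_prop
    have h2 : ContDiff ℝ 1 (fun x : ℝ => 2*ℓ - x) := by fun_prop
    exact ((hP.comp h1).add (hQ.comp h2)).add contDiff_const
  have dz : ∀ P : ℝ → ℝ, (∀ x, L ≤ x → P x = -1) → ∀ x, L < x → deriv P x = 0 := by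
    intro P hP1 x hx
    have : P =ᶠ[nhds x] fun _ => -1 := by
      filter_upwards [lt_mem_nhds hx] with y hy using hP1 y hy.le
    rw [this.deriv_eq]; simp
  have hvd : ∀ x, deriv v x = deriv P (x + 2*ℓ) - deriv Q (2*ℓ - x) := by
    intro x
    have h1 := (hPd (x + 2*ℓ)).comp_add_const x (2*ℓ)
    have h2 := (hQd (2*ℓ - x)).comp_const_sub (2*ℓ) x
    have := ((h1.add h2).add_const 1).deriv
    rw [sub_eq_add_neg, ← this]
    rfl
  refine ⟨v, hv, ?_, ?_, ?_⟩
  · simp only [v]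
    rw [hQ1 (2*ℓ - -(2*ℓ)) (by linarith), neg_add_cancel, hP0]; ring
  · simp only [v]
    rw [hP1 (2*ℓ + 2*ℓ) (by linarith), sub_self, hQ0]; ring
  · rw [energy_split hV v hv (-(2*ℓ)) 0 (2*ℓ)]
    have e1 : energy V (-(2*ℓ)) 0 v = energy V 0 (2*ℓ) P := by
      have h1 : energy V 0 (2*ℓ) P =
          ∫ x in (-(2*ℓ))..0, ((1/2) * (deriv P (x + 2*ℓ))^2 + V (P (x + 2*ℓ))) := by
        rw [intervalIntegral.integral_comp_add_right
          (fun x => (1/2) * (deriv P x)^2 + V (P x)) (2*ℓ)]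
        simp [energy]
      rw [h1]
      unfold energy
      apply intervalIntegral.integral_congr_ae
      have : ∀ᵐ x : ℝ, x ≠ 0 := by simp [ae_iff]
      filter_upwards [this] with x hx0 hx
      rw [Set.uIoc_of_le (by linarith)] at hx
      have hx' : x < 0 := lt_of_le_of_ne hx.2 hx0
      rw [hvd, dz Q hQ1 (2*ℓ - x) (by linarith)]
      simp only [v]
      rw [hQ1 (2*ℓ - x) (by linarith)]
      simp
    have e2 : energy V 0 (2*ℓ) v = energy V 0 (2*ℓ) Q := by
      have h1 : energy V 0 (2*ℓ) Q =
          ∫ x in (0:ℝ)..(2*ℓ), ((1/2) * (deriv Q (2*ℓ - x))^2 + V (Q (2*ℓ - x))) := by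
        rw [intervalIntegral.integral_comp_sub_left
          (fun x => (1/2) * (deriv Q x)^2 + V (Q x)) (2*ℓ)]
        simp [energy]
      rw [h1]
      unfold energy
      apply intervalIntegral.integral_congr_ae
      apply Filter.Eventually.of_forall
      intro x hx
      rw [Set.uIoc_of_le (by linarith)] at hx
      rw [hvd, dz P hP1 (x + 2*ℓ) (by linarith [hx.1])]
      simp only [v]
      rw [hP1 (x + 2*ℓ) (by linarith [hx.1])]
      simp
    rw [e1, e2, tail P hP hP1, tail Q hQ hQ1]
    linarith

/-- Cost of an excursion away from `−1` for paths confined below `1` (Lemma 6.1): for paths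
staying below `1 − δ/2` on `[−2ℓ, 2ℓ]` and reaching above `−δ/2` somewhere in `[−ℓ, ℓ]`,
the minimal energy on `(−2ℓ, 2ℓ)` exceeds the unconstrained one by at least `c₀ − Cδ`. -/
theorem excursion_cost_below_one
    (V : ℝ → ℝ) (hV : Assumption1 V) :
    ∃ C : ℝ, 0 < C ∧ ∃ M₀ : ℝ, ∀ M : ℝ, M₀ ≤ M →
      ∃ δ₀ : ℝ, 0 < δ₀ ∧ ∀ δ : ℝ, 0 < δ → δ ≤ δ₀ →
        ∃ ℓ₀ : ℝ, ∀ ℓ : ℝ, ℓ₀ ≤ ℓ →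
          ∀ um up : ℝ, um ∈ Set.Icc (-M) (1-δ) → up ∈ Set.Icc (-M) (1-δ) →
            c0 V - C * δ ≤
              sInf {e : ℝ | ∃ u : ℝ → ℝ, ContDiff ℝ 1 u ∧
                  u (-(2*ℓ)) = um ∧ u (2*ℓ) = up ∧
                  (∀ x ∈ Set.Icc (-(2*ℓ)) (2*ℓ), u x ≤ 1 - δ/2) ∧
                  (∃ x₀ ∈ Set.Icc (-ℓ) ℓ, -δ/2 ≤ u x₀) ∧
                  e = energy V (-(2*ℓ)) (2*ℓ) u} -
              sInf {e : ℝ | ∃ u : ℝ → ℝ, ContDiff ℝ 1 u ∧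
                  u (-(2*ℓ)) = um ∧ u (2*ℓ) = up ∧
                  e = energy V (-(2*ℓ)) (2*ℓ) u} := by
  obtain ⟨m, hm⟩ := (isCompact_Icc (a := (-1:ℝ)) (b := 0)).exists_bound_of_continuousOn
    (f := fun s => Real.sqrt (2 * V s)) (cphi hV).continuousOn
  have hm0 : 0 ≤ m := (norm_nonneg _).trans (hm 0 (by simp))
  have hPhic : Continuous (Phi V) :=
    continuous_iff_continuousAt.2 fun t => (Phi_deriv hV t).continuousAt
  refine ⟨m + 6, by linarith, 0, fun M _ => ⟨1/2, by norm_num, fun δ hδ hδ1 => ?_⟩⟩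
  obtain ⟨D, hD⟩ := (isCompact_Icc (a := -M) (b := (1:ℝ))).exists_bound_of_continuousOn
    (f := Phi V) hPhic.continuousOn
  obtain ⟨L, hL, hup⟩ := upper hV M δ hδ
  -- closeness
  obtain ⟨ρ, hρ, hρ1, hρΦ⟩ : ∃ ρ : ℝ, 0 < ρ ∧ ρ ≤ 1 ∧ ∀ u, |u + 1| < ρ → |Phi V u| ≤ δ := by
    obtain ⟨ρ, hρ, h⟩ := Metric.continuousAt_iff.1 (hPhic.continuousAt (x := -1)) δ hδ
    refine ⟨min ρ 1, by positivity, min_le_right _ _, fun u hu => ?_⟩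
    have := @h u (by rw [Real.dist_eq, sub_neg_eq_add]; exact hu.trans_le (min_le_left _ _))
    rw [Phi_neg_one, Real.dist_eq, sub_zero] at this
    exact this.le
  obtain ⟨η, hη, hηV⟩ := V_eta hV δ ρ hδ (by linarith) hρ hρ1
  set K := |c0 V| + 2 * |D| + 2 with hK
  have hK0 : 0 < K := by positivity
  refine ⟨max L ((K + 1) / η), fun ℓ hℓ um up hum hup' => ?_⟩
  have hℓL : L ≤ ℓ := (le_max_left _ _).trans hℓ
  have hℓη : K < η * ℓ := by
    have : (K + 1) / η ≤ ℓ := (le_max_right _ _).trans hℓ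
    rw [div_le_iff₀ hη] at this
    nlinarith
  have hℓ0 : 0 < ℓ := hL.trans_le hℓL
  have hum' : um ∈ Set.Icc (-M) 1 := ⟨hum.1, by linarith [hum.2]⟩
  have hup'' : up ∈ Set.Icc (-M) 1 := ⟨hup'.1, by linarith [hup'.2]⟩
  have hDm : |Phi V um| ≤ |D| := (hD um hum').trans (le_abs_self _)
  have hDp : |Phi V up| ≤ |D| := (hD up hup'').trans (le_abs_self _)
  -- upper bound of the unconstrained infimum
  obtain ⟨v, hv, hv1, hv2, hve⟩ := hup ℓ (by linarith) um hum' up hup''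
  have hB : sInf {e : ℝ | ∃ u : ℝ → ℝ, ContDiff ℝ 1 u ∧
                  u (-(2*ℓ)) = um ∧ u (2*ℓ) = up ∧
                  e = energy V (-(2*ℓ)) (2*ℓ) u} ≤ |Phi V um| + |Phi V up| + 2 * δ := by
    refine le_trans (csInf_le ?_ ⟨v, hv, hv1, hv2, rfl⟩) hve
    refine ⟨0, ?_⟩
    rintro e ⟨u, _, _, _, rfl⟩
    exact energy_nonneg hV u _ _ (by linarith)
  have hΦ0 : Phi V 0 - m * δ / 2 ≤ Phi V (-δ/2) := by
    have h := Convex.norm_image_sub_le_of_norm_hasDerivWithin_le (f := Phi V)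
      (f' := fun s => Real.sqrt (2 * V s)) (s := Set.Icc (-1:ℝ) 0) (C := m)
      (fun x _ => (Phi_deriv hV x).hasDerivWithinAt) (fun x hx => hm x hx) (convex_Icc _ _)
      (x := -δ/2) (y := 0) ⟨by linarith, by linarith⟩ ⟨by norm_num, le_rfl⟩
    rw [Real.norm_eq_abs, Real.norm_eq_abs, abs_of_nonneg (show 0 ≤ 0 - -δ/2 by linarith)] at h
    have := (le_abs_self _).trans h
    linarith
  have hA : |Phi V um| + |Phi V up| + 2 * δ + (c0 V - (m + 6) * δ) ≤
      sInf {e : ℝ | ∃ u : ℝ → ℝ, ContDiff ℝ 1 u ∧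
                  u (-(2*ℓ)) = um ∧ u (2*ℓ) = up ∧
                  (∀ x ∈ Set.Icc (-(2*ℓ)) (2*ℓ), u x ≤ 1 - δ/2) ∧
                  (∃ x₀ ∈ Set.Icc (-ℓ) ℓ, -δ/2 ≤ u x₀) ∧
                  e = energy V (-(2*ℓ)) (2*ℓ) u} := by
    apply le_csInf
    · let w : ℝ → ℝ := fun x => (x/(2*ℓ))^2 * (um + (up - um) * ((x/(2*ℓ) + 1)/2))
        + (1 - (x/(2*ℓ))^2) * (1 - δ)
      have hne : 2 * ℓ ≠ 0 := by positivity
      refine ⟨_, w, by fun_prop, ?_, ?_, ?_, ⟨0, ⟨by linarith, hℓ0.le⟩, ?_⟩, rfl⟩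
      · simp [w, neg_div, div_self hne]
      · simp [w, div_self hne]
      · intro x hx
        have h1 : -1 ≤ x/(2*ℓ) := by rw [le_div_iff₀ (by positivity)]; linarith [hx.1]
        have h2 : x/(2*ℓ) ≤ 1 := by rw [div_le_iff₀ (by positivity)]; linarith [hx.2]
        simp only [w]
        generalize x/(2*ℓ) = t at h1 h2
        have h3 : um + (up - um) * ((t + 1)/2) ≤ 1 - δ := by nlinarith [hum.2, hup'.2]
        have h4 := mul_le_mul_of_nonneg_left h3 (sq_nonneg t)
        nlinarith
      · simp only [w]; norm_num; linarith
    · rintro e ⟨u, hu, hu1, hu2, hu3, ⟨x₀, hx₀, hux₀⟩, rfl⟩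
      by_cases hbig : K ≤ energy V (-(2*ℓ)) (2*ℓ) u
      · have := le_abs_self (c0 V)
        nlinarith
      · push Not at hbig
        have s1 := energy_split hV u hu (-(2*ℓ)) (-ℓ) (2*ℓ)
        have s2 := energy_split hV u hu (-ℓ) ℓ (2*ℓ)
        have n1 := energy_nonneg hV u (-(2*ℓ)) (-ℓ) (by linarith)
        have n2 := energy_nonneg hV u (-ℓ) ℓ (by linarith)
        have n3 := energy_nonneg hV u ℓ (2*ℓ) (by linarith)
        obtain ⟨y₁, hy₁, hV₁⟩ := exists_low hV u hu (-(2*ℓ)) (-ℓ) η (by linarith)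
          (by nlinarith)
        obtain ⟨y₂, hy₂, hV₂⟩ := exists_low hV u hu ℓ (2*ℓ) η (by linarith)
          (by nlinarith)
        have hclose : ∀ y ∈ Set.Icc (-(2*ℓ)) (2*ℓ), V (u y) < η → |Phi V (u y)| ≤ δ := by
          intro y hy hVy
          apply hρΦ
          by_contra hcon
          exact absurd (hηV (u y) (hu3 y hy) (not_lt.1 hcon)) (not_le.2 hVy)
        have c1 := abs_le.1 (hclose y₁ ⟨hy₁.1, by linarith [hy₁.2]⟩ hV₁)
        have c2 := abs_le.1 (hclose y₂ ⟨by linarith [hy₂.1], hy₂.2⟩ hV₂)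
        have l1 := energy_lower hV u hu (-(2*ℓ)) y₁ hy₁.1
        have l2 := energy_lower hV u hu y₁ x₀ (by linarith [hy₁.2, hx₀.1])
        have l3 := energy_lower hV u hu x₀ y₂ (by linarith [hy₂.1, hx₀.2])
        have l4 := energy_lower hV u hu y₂ (2*ℓ) hy₂.2
        have t1 := energy_split hV u hu (-(2*ℓ)) y₁ (2*ℓ)
        have t2 := energy_split hV u hu y₁ x₀ (2*ℓ)
        have t3 := energy_split hV u hu x₀ y₂ (2*ℓ)
        have hx := Phi_mono hV hux₀
        have hc := two_Phi_zero hV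
        rw [hu1] at l1
        rw [hu2] at l4
        have l1' : |Phi V um| - δ ≤ energy V (-(2*ℓ)) y₁ u := by
          have := abs_le.1 l1
          rcases abs_cases (Phi V um) with h | h <;> linarith
        have l4' : |Phi V up| - δ ≤ energy V y₂ (2*ℓ) u := by
          have := abs_le.1 l4
          rcases abs_cases (Phi V up) with h | h <;> linarith
        have l2' := abs_le.1 l2
        have l3' := abs_le.1 l3
        linarith
  linarith
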